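/- arXiv:math/0605773 — 2 statements merged into one kernel-verified Lean document; each statement's English description precedes it below -/
import Mathlib

section
/- Let A and A' be Morita equivalent noetherian semiperfect K-algebras. If A is quasi-Koszul, then so is A'. -/
/- STATEMENT 5: Morita invariance of quasi-Koszulity: if A and A' are Morita
equivalent noetherian semiperfect K-algebras and A is quasi-Koszul, then so is A'. -/

open CategoryTheory

universe u

noncomputable instance (A : Type u) [Ring A] : HasDerivedCategory (ModuleCat.{u} A) :=
  HasDerivedCategory.standard _

instance (A : Type u) [Ring A] : HasExt.{u+1} (ModuleCat.{u} A) :=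
  CategoryTheory.hasExt_of_hasDerivedCategory _

/-- The Jacobson radical of a ring, as a left ideal. -/
def jacRad (A : Type u) [Ring A] : Ideal A := Ideal.jacobson ⊥

/-- The semisimple quotient `A/J(A)` as a left `A`-module. -/
abbrev ssQuot (A : Type u) [Ring A] : ModuleCat.{u} A :=
  ModuleCat.of A (A ⧸ jacRad A)

/-- A ring is semiperfect if `A/J(A)` is semisimple and idempotents lift
modulo the Jacobson radical. -/
def IsSemiperfectRing (A : Type u) [Ring A] : Prop :=
  IsSemisimpleModule A (A ⧸ jacRad A) ∧
    ∀ a : A, a * a - a ∈ jacRad A →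
      ∃ e : A, IsIdempotentElem e ∧ e - a ∈ jacRad A

/-- Additive span of Yoneda products. -/
noncomputable def extSpan {C : Type (u+1)} [Category C] [Abelian C] [HasExt.{u+1} C]
    (X Y Z : C) (r l : ℕ) : AddSubgroup (Abelian.Ext X Z (r + l)) :=
  AddSubgroup.closure { γ | ∃ (α : Abelian.Ext X Y r) (β : Abelian.Ext Y Z l), γ = α.comp β rfl }

/-- A ring `A` is quasi-Koszul if its Yoneda algebra `Ext^*_A(A/J, A/J)` is generated in
degrees 0 and 1: `Ext^i · Ext^1 = Ext^{i+1}` for all `i ≥ 0`. -/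
def IsQuasiKoszul (A : Type u) [Ring A] : Prop :=
  ∀ i : ℕ, extSpan (ssQuot A) (ssQuot A) (ssQuot A) i 1 = ⊤

/-- An `A`-module `M` is quasi-Koszul if
`Ext^i_A(M, A/J) · Ext^1_A(A/J, A/J) = Ext^{i+1}_A(M, A/J)` for all `i ≥ 0`. -/
def IsQuasiKoszulModule (A : Type u) [Ring A] (M : ModuleCat.{u} A) : Prop :=
  ∀ i : ℕ, extSpan M (ssQuot A) (ssQuot A) i 1 = ⊤

namespace CategoryTheory

open Limits Abelian

/-- The identity of `X` is a finite sum of endomorphisms that factor through `Y`; when finite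
biproducts exist, this says that `X` is a direct summand of some `Yⁿ`. -/
def IsSummandOfPower {C : Type*} [Category C] [Preadditive C] (X Y : C) : Prop :=
  ∃ (n : ℕ) (f : Fin n → (X ⟶ Y)) (g : Fin n → (Y ⟶ X)), 𝟙 X = ∑ i, f i ≫ g i

namespace IsSummandOfPower

section Preadditive

variable {C D : Type*} [Category C] [Preadditive C] [Category D] [Preadditive D]

lemma map {X Y : C} (h : IsSummandOfPower X Y) (F : C ⥤ D) [F.Additive] :
    IsSummandOfPower (F.obj X) (F.obj Y) := by
  obtain ⟨n, f, g, hfg⟩ := h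
  refine ⟨n, fun i => F.map (f i), fun i => F.map (g i), ?_⟩
  rw [← F.map_id, hfg, F.map_sum]
  simp

lemma of_iso {X X' Y : C} (h : IsSummandOfPower X Y) (e : X ≅ X') :
    IsSummandOfPower X' Y := by
  obtain ⟨n, f, g, hfg⟩ := h
  refine ⟨n, fun i => e.inv ≫ f i, fun i => g i ≫ e.hom, ?_⟩
  have : e.inv ≫ 𝟙 X ≫ e.hom = 𝟙 X' := by simp
  rw [← this, hfg]
  simp [Preadditive.sum_comp, Preadditive.comp_sum]

end Preadditive

variable {C : Type*} [Category C] [Abelian C] [HasExt C]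

lemma ext_eq_sum_left {X Y Z : C} {n : ℕ} {f : Fin n → (X ⟶ Y)} {g : Fin n → (Y ⟶ X)}
    (h : 𝟙 X = ∑ i, f i ≫ g i) {r : ℕ} (γ : Ext X Z r) :
    γ = ∑ i, (Ext.mk₀ (f i)).comp ((Ext.mk₀ (g i)).comp γ (zero_add r)) (zero_add r) := by
  conv_lhs => rw [← Ext.mk₀_id_comp γ, h, Ext.mk₀_sum, Ext.sum_comp]
  simp

lemma ext_eq_sum_right {X Y Z : C} {n : ℕ} {f : Fin n → (X ⟶ Y)} {g : Fin n → (Y ⟶ X)}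
    (h : 𝟙 X = ∑ i, f i ≫ g i) {r : ℕ} (γ : Ext Z X r) :
    γ = ∑ i, (γ.comp (Ext.mk₀ (f i)) (add_zero r)).comp (Ext.mk₀ (g i)) (add_zero r) := by
  conv_lhs => rw [← Ext.comp_mk₀_id γ, h, Ext.mk₀_sum, Ext.comp_sum]
  simp

end IsSummandOfPower

section ExtSpan

variable {C : Type (u + 1)} [Category.{u} C] [Abelian C] [HasExt.{u + 1} C]

lemma comp_mem_extSpan_of_isSummandOfPower {X Y Y' Z : C} (h : IsSummandOfPower Y Y') {r l : ℕ}
    (α : Ext X Y r) (β : Ext Y Z l) : α.comp β rfl ∈ extSpan X Y' Z r l := by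
  obtain ⟨n, f, g, hfg⟩ := h
  rw [IsSummandOfPower.ext_eq_sum_left hfg β, Ext.comp_sum]
  refine sum_mem fun i _ => AddSubgroup.subset_closure
    ⟨α.comp (Ext.mk₀ (f i)) (add_zero r), (Ext.mk₀ (g i)).comp β (zero_add l), ?_⟩
  rw [Ext.comp_assoc_of_second_deg_zero]

lemma extSpan_eq_top_of_isSummandOfPower {S T : C} (hTS : IsSummandOfPower T S)
    (hST : IsSummandOfPower S T) {r l : ℕ} (h : extSpan S S S r l = ⊤) :
    extSpan T T T r l = ⊤ := by
  have key (f : T ⟶ S) (g : S ⟶ T) (γ : Ext S S (r + l)) :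
      ((Ext.mk₀ f).comp γ (zero_add _)).comp (Ext.mk₀ g) (add_zero _) ∈ extSpan T T T r l := by
    have hγ : γ ∈ extSpan S S S r l := h ▸ AddSubgroup.mem_top γ
    induction hγ using AddSubgroup.closure_induction with
    | mem x hx =>
      obtain ⟨α, β, rfl⟩ := hx
      convert comp_mem_extSpan_of_isSummandOfPower hST ((Ext.mk₀ f).comp α (zero_add r))
        (β.comp (Ext.mk₀ g) (add_zero l)) using 1
      rw [← Ext.comp_assoc_of_third_deg_zero]
      congr 1
      exact (Ext.comp_assoc _ _ _ _ _ (by omega)).symm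
    | zero => simp
    | add x y _ _ hx hy => simpa using add_mem hx hy
    | neg x _ hx => simpa using hx
  obtain ⟨n, f, g, hfg⟩ := hTS
  refine eq_top_iff.mpr fun γ _ => ?_
  rw [IsSummandOfPower.ext_eq_sum_right hfg γ]
  refine sum_mem fun j _ => ?_
  rw [IsSummandOfPower.ext_eq_sum_left hfg γ, Ext.sum_comp, Ext.sum_comp]
  refine sum_mem fun i _ => ?_
  have := key (f i) (g j) (((Ext.mk₀ (g i)).comp γ (zero_add _)).comp (Ext.mk₀ (f j)) (add_zero _))
  rwa [← Ext.comp_assoc_of_third_deg_zero] at this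

lemma extSpan_map_eq_top {D : Type (u + 1)} [Category.{u} D] [Abelian D] [HasExt.{u + 1} D]
    (F : C ⥤ D) [F.IsEquivalence] [F.Additive] [EnoughProjectives C] {X Y Z : C} {r l : ℕ}
    (h : extSpan X Y Z r l = ⊤) : extSpan (F.obj X) (F.obj Y) (F.obj Z) r l = ⊤ := by
  refine eq_top_iff.mpr fun γ' _ => ?_
  obtain ⟨γ, rfl⟩ := (F.mapExt_bijective_of_preservesProjectiveObjects X Z (r + l)).2 γ'
  have hγ : γ ∈ extSpan X Y Z r l := h ▸ AddSubgroup.mem_top γ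
  induction hγ using AddSubgroup.closure_induction with
  | mem x hx =>
    obtain ⟨α, β, rfl⟩ := hx
    exact AddSubgroup.subset_closure
      ⟨α.mapExactFunctor F, β.mapExactFunctor F, Ext.mapExactFunctor_comp F α β rfl⟩
  | zero => simp
  | add x y _ _ hx hy => rw [map_add]; exact add_mem (hx trivial) (hy trivial)
  | neg x _ hx => rw [map_neg]; exact neg_mem (hx trivial)

end ExtSpan

end CategoryTheory

section Semisimple

variable {A : Type u} [Ring A]

/-- A simple module is a retract of `A/J(A)` when the latter is semisimple. -/
lemma exists_retract_ssQuot_of_simple (hA : IsSemisimpleModule A (A ⧸ jacRad A))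
    (M : ModuleCat.{u} A) [Simple M] :
    ∃ (s : M ⟶ ssQuot A) (p : ssQuot A ⟶ M), s ≫ p = 𝟙 M := by
  obtain ⟨I, hI, ⟨e⟩⟩ := isSimpleModule_iff_quot_maximal.mp
    ((simple_iff_isSimpleModule' M).mp inferInstance)
  have hle : jacRad A ≤ I := sInf_le ⟨bot_le, hI⟩
  let q : (A ⧸ jacRad A) →ₗ[A] M := e.symm.toLinearMap ∘ₗ Submodule.factor hle
  have hq : Function.Surjective q := e.symm.surjective.comp (Submodule.factor_surjective hle)
  obtain ⟨s, hs⟩ := IsSemisimpleModule.lifting_property q hq LinearMap.id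
  exact ⟨ModuleCat.ofHom s, ModuleCat.ofHom q, ModuleCat.hom_ext hs⟩

/-- A finitely generated semisimple module is a finite direct sum of simple modules. -/
lemma exists_simple_decomposition (M : Type u) [AddCommGroup M] [Module A M]
    [IsSemisimpleModule A M] [Module.Finite A M] :
    ∃ (n : ℕ) (S : Fin n → ModuleCat.{u} A) (_ : ∀ i, Simple (S i))
      (p : ∀ i, ModuleCat.of A M ⟶ S i) (j : ∀ i, S i ⟶ ModuleCat.of A M),
      𝟙 (ModuleCat.of A M) = ∑ i, p i ≫ j i := by
  obtain ⟨n, S, e, hS⟩ := IsSemisimpleModule.exists_linearEquiv_fin_dfinsupp A M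
  refine ⟨n, fun i => ModuleCat.of A (S i), fun i => simple_iff_isSimpleModule.mpr (hS i),
    fun i => ModuleCat.ofHom (DFinsupp.lapply i ∘ₗ e.toLinearMap),
    fun i => ModuleCat.ofHom (e.symm.toLinearMap ∘ₗ
      (DFinsupp.lsingle (M := fun i => S i) i)), ?_⟩
  ext x
  apply e.injective
  simp only [ModuleCat.hom_sum, LinearMap.sum_apply, map_sum]
  ext i : 1
  simp [DFinsupp.single_apply]

lemma isSummandOfPower_map_ssQuot {A' : Type u} [Ring A']
    (hA : IsSemisimpleModule A (A ⧸ jacRad A))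
    (hA' : IsSemisimpleModule A' (A' ⧸ jacRad A'))
    (F : ModuleCat.{u} A ⥤ ModuleCat.{u} A') [F.IsEquivalence] [F.Additive] :
    IsSummandOfPower (F.obj (ssQuot A)) (ssQuot A') := by
  obtain ⟨n, S, hS, p, j, hpj⟩ := exists_simple_decomposition (A := A) (A ⧸ jacRad A)
  have hFS (i : Fin n) : Simple (F.obj (S i)) := simple_obj F (S i)
  choose s q hsq using fun i => exists_retract_ssQuot_of_simple hA' (F.obj (S i))
  refine ⟨n, fun i => F.map (p i) ≫ s i, fun i => q i ≫ F.map (j i), ?_⟩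
  rw [← F.map_id, hpj, F.map_sum]
  refine Finset.sum_congr rfl fun i _ => ?_
  rw [F.map_comp, Category.assoc, ← Category.assoc (s i), hsq, Category.id_comp]

end Semisimple

theorem stmt5 (K : Type u) [Field K] (A A' : Type u) [Ring A] [Ring A']
    [Algebra K A] [Algebra K A'] [IsNoetherianRing A] [IsNoetherianRing A']
    (hA : IsSemiperfectRing A) (hA' : IsSemiperfectRing A')
    (e : ModuleCat.{u} A ≌ ModuleCat.{u} A')
    (h : IsQuasiKoszul A) : IsQuasiKoszul A' := by
  have : e.functor.Additive := Functor.additive_of_preserves_binary_products _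
  have : e.inverse.Additive := Functor.additive_of_preserves_binary_products _
  intro i
  refine extSpan_eq_top_of_isSummandOfPower ?_ (isSummandOfPower_map_ssQuot hA.1 hA'.1 e.functor)
    (extSpan_map_eq_top e.functor (h i))
  exact ((isSummandOfPower_map_ssQuot hA'.1 hA.1 e.inverse).map e.functor).of_iso
    (e.counitIso.app (ssQuot A'))
end

section
/- Let A be a K-algebra, G a finite group acting on A with char K ∤ |G|, M an A ∗ G-module admitting a resolution by finitely generated projective A ∗ G-modules, N an A ∗ G-module, and W a KG-module. Then for every i ≥ 0 there is a K-vector space isomorphism Ext^i_A(M, N) ⊗_K W ≅ Ext^i_{A∗G}(M ⊗_K KG, N ⊗_K W). -/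
open CategoryTheory

universe u

/-- `B` is a skew group algebra `A ∗ G` for the action `φ` of `G` on the `K`-algebra `A`:
`B` contains `A` and invertible elements indexed by `G` satisfying the skew commutation
rule `g · a = (g a) · g`, and `B` is free as an `A`-module with basis `G`. -/
structure IsSkewGroupAlgebra (K : Type u) [Field K] (A : Type u) [Ring A] [Algebra K A]
    (G : Type u) [Group G] [Fintype G] (φ : G →* (A ≃ₐ[K] A))
    (B : Type u) [Ring B] [Algebra K B] where
  ιA : A →ₐ[K] B
  ιG : G →* B
  comm : ∀ (g : G) (a : A), ιG g * ιA a = ιA (φ g a) * ιG g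
  free : ∀ b : B, ∃! c : G → A, b = ∑ g : G, ιA (c g) * ιG g

/- STATEMENT 11: If char K ∤ |G|, M is an A ∗ G-module with a resolution by finitely
generated projective A ∗ G-modules, N an A ∗ G-module and W a KG-module, then for every
i ≥ 0 there is a K-linear isomorphism
Ext^i_A(M,N) ⊗_K W ≅ Ext^i_{A∗G}(M ⊗_K KG, N ⊗_K W). -/

open TensorProduct Opposite

noncomputable section

namespace IsSkewGroupAlgebra

variable {K : Type u} [Field K] {A : Type u} [Ring A] [Algebra K A]
  {G : Type u} [Group G] [Fintype G] {φ : G →* (A ≃ₐ[K] A)}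
  {B : Type u} [Ring B] [Algebra K B] (H : IsSkewGroupAlgebra K A G φ B)

/-- The coordinates of an element of `B` in the `A`-basis `G`. -/
def coords : B ≃+ (G → A) :=
  AddEquiv.symm <| AddEquiv.ofBijective
    (⟨⟨fun c => ∑ g, H.ιA (c g) * H.ιG g, by simp⟩, fun c d => by
      simp [add_mul, Finset.sum_add_distrib]⟩ : (G → A) →+ B)
    ⟨fun c d h => (H.free (∑ g, H.ιA (d g) * H.ιG g)).unique h.symm rfl, fun b => by
      obtain ⟨c, hc, -⟩ := H.free b
      exact ⟨c, hc.symm⟩⟩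

lemma coords_symm_apply (c : G → A) :
    H.coords.symm c = ∑ g, H.ιA (c g) * H.ιG g := rfl

lemma coords_ιG (g : G) [DecidableEq G] : H.coords (H.ιG g) = Pi.single g 1 := by
  rw [← AddEquiv.eq_symm_apply, coords_symm_apply, Finset.sum_eq_single g]
  · simp
  · intro h _ hh
    simp [hh]
  · simp

lemma coords_ιA_mul (a : A) (b : B) : H.coords (H.ιA a * b) = a • H.coords b := by
  obtain ⟨c, rfl⟩ := H.coords.symm.surjective b
  rw [← AddEquiv.eq_symm_apply, AddEquiv.apply_symm_apply, coords_symm_apply, coords_symm_apply]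
  simp [Finset.mul_sum, mul_assoc]

lemma exists_eq_sum (b : B) : ∃ c : G → A, b = ∑ g, H.ιA (c g) * H.ιG g :=
  (H.free b).exists

/-- An additive map of `B`-modules is linear as soon as it commutes with `A` and `G`. -/
lemma map_smul_of {X Y : Type*} [AddCommGroup X] [AddCommGroup Y] [Module B X] [Module B Y]
    (f : X →+ Y) (hA : ∀ a x, f (H.ιA a • x) = H.ιA a • f x)
    (hG : ∀ g x, f (H.ιG g • x) = H.ιG g • f x) (b : B) (x : X) : f (b • x) = b • f x := by
  obtain ⟨c, rfl⟩ := H.exists_eq_sum b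
  simp only [Finset.sum_smul, map_sum, mul_smul, hA, hG]

/-- The restriction functor from `B`-modules to `A`-modules. -/
abbrev res : ModuleCat.{u} B ⥤ ModuleCat.{u} A :=
  ModuleCat.restrictScalars H.ιA.toRingHom

/-- The coinduction functor from `A`-modules to `B`-modules. -/
abbrev coind : ModuleCat.{u} A ⥤ ModuleCat.{u} B :=
  ModuleCat.coextendScalars H.ιA.toRingHom

/-- The identity map from a `B`-module to its restriction to `A`. -/
def toRes {Y : ModuleCat.{u} B} : Y ≃+ H.res.obj Y := AddEquiv.refl Y

lemma toRes_ιA_smul {Y : ModuleCat.{u} B} (a : A) (y : Y) :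
    H.toRes (H.ιA a • y) = a • H.toRes y := rfl

lemma toRes_symm_smul {Y : ModuleCat.{u} B} (a : A) (y : H.res.obj Y) :
    H.toRes.symm (a • y) = H.ιA a • H.toRes.symm y := rfl

/-- Evaluation of elements of a coinduced module. -/
def ev {X : ModuleCat.{u} A} : H.coind.obj X →+ B →+ X where
  toFun θ :=
    { toFun := fun b => ModuleCat.CoextendScalars.equiv _ _ θ b
      map_zero' := map_zero (ModuleCat.CoextendScalars.equiv _ _ θ)
      map_add' := map_add (ModuleCat.CoextendScalars.equiv _ _ θ) }
  map_zero' := rfl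
  map_add' _ _ := rfl

/-- An element of a coinduced module, from a map which commutes with the action of `A`. -/
def mkCoind {X : ModuleCat.{u} A} (f : B →+ X) (hf : ∀ a b, f (H.ιA a * b) = a • f b) :
    H.coind.obj X :=
  (ModuleCat.CoextendScalars.equiv _ _).symm
    { toFun := fun b => f b
      map_add' := map_add f
      map_smul' := hf }

lemma ev_ιA_mul {X : ModuleCat.{u} A} (θ : H.coind.obj X) (a : A) (b : B) :
    H.ev θ (H.ιA a * b) = a • H.ev θ b :=
  map_smul (ModuleCat.CoextendScalars.equiv _ _ θ) a _

lemma ev_smul {X : ModuleCat.{u} A} (b : B) (θ : H.coind.obj X) (x : B) :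
    H.ev (b • θ) x = H.ev θ (x * b) := rfl

variable {H} in
/-- Elements of a coinduced module are determined by their values on `G`. -/
lemma coind_ext {X : ModuleCat.{u} A} {θ θ' : H.coind.obj X}
    (h : ∀ g, H.ev θ (H.ιG g) = H.ev θ' (H.ιG g)) : θ = θ' := by
  have key : H.ev θ = H.ev θ' := by
    ext b
    obtain ⟨c, rfl⟩ := H.exists_eq_sum b
    simp only [map_sum, ev_ιA_mul, h]
  exact ModuleCat.CoextendScalars.ext (LinearMap.ext fun b => DFunLike.congr_fun key b)

/-- The `A`-linear map `B → X` sending `1` to `x` and the other elements of `G` to `0`. -/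
def delta {X : ModuleCat.{u} A} : X →+ H.coind.obj X where
  toFun x := H.mkCoind
    ((AddMonoidHom.flip (smulAddHom A X) x).comp
      ((Pi.evalAddMonoidHom _ 1).comp H.coords.toAddMonoidHom))
    (fun a b => by simp [coords_ιA_mul, mul_smul])
  map_zero' := coind_ext fun g => smul_zero _
  map_add' _ _ := coind_ext fun g => smul_add _ _ _

lemma ev_delta {X : ModuleCat.{u} A} [DecidableEq G] (x : X) (g : G) :
    H.ev (H.delta x) (H.ιG g) = if g = 1 then x else 0 := by
  change H.coords (H.ιG g) 1 • x = _
  rw [coords_ιG]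
  by_cases h : g = 1
  · simp [h]
  · simp [h, Ne.symm h]

lemma ιA_smul_delta {X : ModuleCat.{u} A} (a : A) (x : X) :
    H.ιA a • H.delta x = H.delta (a • x) := by
  classical
  refine coind_ext fun g => ?_
  rw [ev_smul, H.comm, ev_ιA_mul, ev_delta, ev_delta]
  by_cases h : g = 1 <;> simp [h]

lemma sum_smul_delta {X : ModuleCat.{u} A} (θ : H.coind.obj X) :
    ∑ g, H.ιG g • H.delta (H.ev θ (H.ιG g⁻¹)) = θ := by
  classical
  refine coind_ext fun h => ?_
  rw [map_sum, AddMonoidHom.finsetSum_apply, Finset.sum_eq_single h⁻¹]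
  · rw [ev_smul, ← map_mul, ev_delta]
    simp
  · intro g _ hg
    rw [ev_smul, ← map_mul, ev_delta, if_neg]
    rwa [mul_eq_one_iff_inv_eq, eq_comm]
  · simp

/-- The additive map underlying `trace`. -/
def traceAddHom (Y : ModuleCat.{u} B) : H.coind.obj (H.res.obj Y) →+ Y where
  toFun θ := ∑ g, H.ιG g • H.toRes.symm (H.ev θ (H.ιG g⁻¹))
  map_zero' := by simp
  map_add' θ θ' := by simp [Finset.sum_add_distrib]

/-- The trace map `θ ↦ ∑ g θ(g⁻¹)`. -/
def trace (Y : ModuleCat.{u} B) : H.coind.obj (H.res.obj Y) →ₗ[B] Y where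
  toFun := H.traceAddHom Y
  map_add' := map_add _
  map_smul' := H.map_smul_of (H.traceAddHom Y)
    (fun a θ => by
      simp only [traceAddHom, AddMonoidHom.coe_mk, ZeroHom.coe_mk, Finset.smul_sum]
      refine Finset.sum_congr rfl fun g _ => ?_
      rw [ev_smul, H.comm, ev_ιA_mul, toRes_symm_smul, ← mul_smul, ← mul_smul, H.comm]
      simp)
    (fun h θ => by
      simp only [traceAddHom, AddMonoidHom.coe_mk, ZeroHom.coe_mk, Finset.smul_sum]
      rw [← Equiv.sum_comp (Equiv.mulLeft h)]
      refine Finset.sum_congr rfl fun g _ => ?_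
      rw [ev_smul, ← mul_smul, ← map_mul, ← map_mul]
      simp)

lemma trace_apply (Y : ModuleCat.{u} B) (θ : H.coind.obj (H.res.obj Y)) :
    H.trace Y θ = ∑ g, H.ιG g • H.toRes.symm (H.ev θ (H.ιG g⁻¹)) := rfl

lemma trace_delta (Y : ModuleCat.{u} B) (y : Y) :
    H.trace Y (H.delta (H.toRes y)) = y := by
  classical
  rw [trace_apply, Finset.sum_eq_single 1]
  · rw [ev_delta]
    simp
  · intro g _ hg
    rw [ev_delta, if_neg (by simpa using hg)]
    simp
  · simp

/-- Coinduction along `A → A ∗ G` is left adjoint to restriction. -/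
def coindResAdj : H.coind ⊣ H.res :=
  Adjunction.mkOfUnitCounit
    { unit :=
        { app := fun X => ModuleCat.ofHom (Y := H.res.obj (H.coind.obj X))
            { toFun := fun x => H.toRes (H.delta x)
              map_add' := by simp
              map_smul' := fun a x => congrArg H.toRes (H.ιA_smul_delta a x).symm }
          naturality := fun X Y f => by
            classical
            ext x
            refine coind_ext (H := H) (X := Y) fun g => ?_
            change H.ev (H.delta (f x)) (H.ιG g) = f (H.ev (H.delta x) (H.ιG g))
            rw [ev_delta, ev_delta]
            split_ifs <;> simp }
      counit :=
        { app := fun Y => ModuleCat.ofHom (H.trace Y)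
          naturality := fun X Y f => by
            refine ModuleCat.hom_ext (LinearMap.ext fun (θ : H.coind.obj (H.res.obj X)) => ?_)
            change _ = f (H.trace X θ)
            rw [trace_apply, map_sum]
            simp only [map_smul]
            rfl }
      left_triangle := by
        refine NatTrans.ext (funext fun X => ModuleCat.hom_ext (LinearMap.ext fun θ => ?_))
        exact H.sum_smul_delta θ
      right_triangle := by
        refine NatTrans.ext (funext fun Y => ModuleCat.hom_ext (LinearMap.ext fun y => ?_))
        exact H.trace_delta Y y }

instance : H.res.Linear K where
  map_smul f k := by
    ext x
    exact congrArg (· • f.hom x) (H.ιA.commutes k).symm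

instance : H.coind.Additive := H.coindResAdj.left_adjoint_additive

instance : H.res.IsLeftAdjoint := (ModuleCat.restrictCoextendScalarsAdj _).isLeftAdjoint

instance : H.coind.IsRightAdjoint := (ModuleCat.restrictCoextendScalarsAdj _).isRightAdjoint

instance : H.coind.IsLeftAdjoint := H.coindResAdj.isLeftAdjoint

instance : H.res.IsRightAdjoint := H.coindResAdj.isRightAdjoint

instance : H.coind.PreservesProjectiveObjects :=
  Functor.preservesProjectiveObjects_of_adjunction_of_preservesEpimorphisms H.coindResAdj

instance : H.res.PreservesProjectiveObjects :=
  Functor.preservesProjectiveObjects_of_adjunction_of_preservesEpimorphisms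
    (ModuleCat.restrictCoextendScalarsAdj H.ιA.toRingHom)

/-- An isomorphism with a restricted module, from an additive equivalence commuting with the
action of `A`. -/
def isoRes {X : Type u} [AddCommGroup X] [Module A X] {Y : Type u} [AddCommGroup Y] [Module B Y]
    (e : X ≃+ Y) (he : ∀ (a : A) x, e (a • x) = H.ιA a • e x) :
    ModuleCat.of A X ≅ H.res.obj (ModuleCat.of B Y) :=
  LinearEquiv.toModuleIso (LinearEquiv.ofBijective
    (ModuleCat.ofHom (X := X) (Y := H.res.obj (ModuleCat.of B Y))
      { toFun := e, map_add' := map_add e, map_smul' := he }).hom e.bijective)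

/-- Restriction to `A` preserves finite generation. -/
lemma finite_res (P : ModuleCat.{u} B) [Module.Finite B P] : Module.Finite A (H.res.obj P) := by
  obtain ⟨s, hs⟩ := Module.Finite.fg_top (R := B) (M := P)
  classical
  refine ⟨⟨(Finset.univ ×ˢ s).image fun p : G × P => H.toRes (H.ιG p.1 • p.2), ?_⟩⟩
  rw [eq_top_iff]
  set S : Submodule A (H.res.obj P) := Submodule.span A _
  have key (y : P) : ∀ g : G, H.toRes (H.ιG g • y) ∈ S := by
    have hy : y ∈ Submodule.span B (s : Set P) := hs ▸ Submodule.mem_top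
    induction hy using Submodule.span_induction with
    | mem y hy =>
      exact fun g => Submodule.subset_span (by simpa using ⟨g, y, hy, rfl⟩)
    | zero => simp
    | add y z _ _ hy hz => exact fun g => by simpa using S.add_mem (hy g) (hz g)
    | smul b y _ hy =>
      intro g
      obtain ⟨c, rfl⟩ := H.exists_eq_sum b
      rw [Finset.sum_smul, Finset.smul_sum, map_sum]
      refine S.sum_mem fun h _ => ?_
      rw [← mul_smul, ← mul_assoc, H.comm, mul_assoc, ← map_mul, mul_smul, toRes_ιA_smul]
      exact S.smul_mem _ (hy _)
  rintro x -
  obtain ⟨y, rfl⟩ := H.toRes.surjective x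
  simpa using key y 1

section Induced

variable {M : Type u} [AddCommGroup M] [Module B M] [Module K M]
  [Module B (M ⊗[K] MonoidAlgebra K G)]

/-- The twisted module `M ⊗ KG` is (co)induced from the restriction of `M` to `A`. -/
theorem nonempty_coind_iso
    (hMKG : ∀ (a : A) (g : G) (m : M) (h : G),
      (H.ιA a * H.ιG g) • (m ⊗ₜ[K] MonoidAlgebra.of K G h) =
        ((H.ιA a * H.ιG g) • m) ⊗ₜ[K] MonoidAlgebra.of K G (g * h)) :
    Nonempty (H.coind.obj (H.res.obj (ModuleCat.of B M)) ≅
      ModuleCat.of B (M ⊗[K] MonoidAlgebra K G)) := by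
  classical
  let T := ModuleCat.of B (M ⊗[K] MonoidAlgebra K G)
  have hA (a : A) (m : M) (h : G) : H.ιA a • (m ⊗ₜ[K] MonoidAlgebra.of K G h) =
      (H.ιA a • m) ⊗ₜ[K] MonoidAlgebra.of K G h := by
    simpa using hMKG a 1 m h
  have hG (g : G) (m : M) (h : G) : H.ιG g • (m ⊗ₜ[K] MonoidAlgebra.of K G h) =
      (H.ιG g • m) ⊗ₜ[K] MonoidAlgebra.of K G (g * h) := by
    simpa using hMKG 1 g m h
  let j : H.res.obj (ModuleCat.of B M) ⟶ H.res.obj T := ModuleCat.ofHom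
    (X := H.res.obj (ModuleCat.of B M)) (Y := H.res.obj T)
    { toFun := fun m => H.toRes (Y := T) ((H.toRes.symm m : M) ⊗ₜ[K] MonoidAlgebra.of K G 1)
      map_add' := fun m m' => congrArg (H.toRes (Y := T)) (TensorProduct.add_tmul _ _ _)
      map_smul' := fun a m => congrArg (H.toRes (Y := T)) (hA a _ 1).symm }
  let f : H.coind.obj (H.res.obj (ModuleCat.of B M)) →ₗ[B] T :=
    H.trace T ∘ₗ (H.coind.map j).hom
  have hf (θ : H.coind.obj (H.res.obj (ModuleCat.of B M))) :
      f θ = ∑ g, (H.ιG g • H.toRes.symm (H.ev θ (H.ιG g⁻¹)) : M) ⊗ₜ[K] MonoidAlgebra.of K G g := by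
    change H.trace T (H.coind.map j θ) = _
    rw [trace_apply]
    refine Finset.sum_congr rfl fun g _ => ?_
    have := hG g (H.toRes.symm (H.ev θ (H.ιG g⁻¹))) 1
    rw [mul_one] at this
    exact this
  refine ⟨(LinearEquiv.ofBijective f ⟨?_, ?_⟩).toModuleIso⟩
  · intro θ θ' h
    refine coind_ext fun g => ?_
    have key (θ : H.coind.obj (H.res.obj (ModuleCat.of B M))) :
        TensorProduct.equivFinsuppOfBasisRight (MonoidAlgebra.basis G K) (f θ) g⁻¹ =
        (H.ιG g⁻¹ • H.toRes.symm (H.ev θ (H.ιG g)) : M) := by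
      rw [hf, map_sum, Finsupp.finsetSum_apply, Finset.sum_eq_single g⁻¹]
      · rw [TensorProduct.equivFinsuppOfBasisRight_apply_tmul_apply, MonoidAlgebra.of_apply,
          ← MonoidAlgebra.basis_apply, Module.Basis.repr_self]
        simp
      · intro h _ hh
        rw [TensorProduct.equivFinsuppOfBasisRight_apply_tmul_apply, MonoidAlgebra.of_apply,
          ← MonoidAlgebra.basis_apply, Module.Basis.repr_self]
        simp [hh]
      · simp
    have h' := (key θ).symm.trans ((congrArg (fun t => TensorProduct.equivFinsuppOfBasisRight
      (MonoidAlgebra.basis G K) t g⁻¹) h).trans (key θ'))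
    have h'' := congrArg (fun m : M => H.ιG g • m) h'
    simpa [← mul_smul, ← map_mul] using h''
  · intro t
    change t ∈ LinearMap.range f
    have hmem (m : M) (g : G) : m ⊗ₜ[K] MonoidAlgebra.of K G g ∈ LinearMap.range f := by
      have h1 : (H.ιG g⁻¹ • m) ⊗ₜ[K] MonoidAlgebra.of K G 1 ∈ LinearMap.range f := by
        refine ⟨H.delta (H.toRes (Y := ModuleCat.of B M) (H.ιG g⁻¹ • m)), ?_⟩
        rw [hf, Finset.sum_eq_single 1]
        · rw [inv_one, ev_delta]
          simp
        · intro h _ hh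
          rw [ev_delta, if_neg (by simpa using hh)]
          simp
        · simp
      have h2 := Submodule.smul_mem _ (H.ιG g) h1
      rwa [hG, ← mul_smul, ← map_mul, mul_inv_cancel, map_one, one_smul, mul_one] at h2
    change M ⊗[K] MonoidAlgebra K G at t
    induction t using TensorProduct.induction_on with
    | zero => exact Submodule.zero_mem _
    | add x y hx hy => exact Submodule.add_mem _ hx hy
    | tmul m x =>
      induction x using MonoidAlgebra.induction_linear with
      | zero => rw [TensorProduct.tmul_zero]; exact Submodule.zero_mem _
      | add x y hx hy => rw [TensorProduct.tmul_add]; exact Submodule.add_mem _ hx hy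
      | single g k =>
        have : MonoidAlgebra.single g k = k • MonoidAlgebra.of K G g := by simp
        rw [this, ← TensorProduct.smul_tmul]
        exact hmem _ _

end Induced

end IsSkewGroupAlgebra

section Ext

/-- The hom-set bijection of an adjunction whose right adjoint is linear, as a linear
equivalence. -/
def homLinearEquivOfAdjunction {K : Type*} [Field K] {C D : Type*} [Category* C] [Category* D]
    [Preadditive C] [Preadditive D] [Linear K C] [Linear K D]
    {F : C ⥤ D} {G : D ⥤ C} (adj : F ⊣ G) [G.Additive] [G.Linear K] (X : C) (Y : D) :
    (F.obj X ⟶ Y) ≃ₗ[K] (X ⟶ G.obj Y) :=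
  { adj.homEquiv X Y with
    map_add' := fun f g => by simp [Adjunction.homEquiv_unit]
    map_smul' := fun k f => by simp [Adjunction.homEquiv_unit] }

/-- Ext groups and adjunctions between exact functors whose left adjoint preserves
projective objects. -/
def extIsoOfAdjunction {K : Type u} [Field K] {C D : Type*} [Category.{u} C] [Category.{u} D]
    [Abelian C] [Abelian D] [EnoughProjectives C] [EnoughProjectives D] [Linear K C] [Linear K D]
    {F : C ⥤ D} {G : D ⥤ C} (adj : F ⊣ G) [F.Additive] [G.Additive] [G.Linear K]
    [F.PreservesProjectiveObjects] [F.PreservesHomology] (X : C) (Y : D) (n : ℕ) :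
    ((_root_.Ext K D n).obj (op (F.obj X))).obj Y ≅
      ((_root_.Ext K C n).obj (op X)).obj (G.obj Y) :=
  let P := projectiveResolution X
  (F.mapProjectiveResolution P).isoExt n Y ≪≫
    (HomologicalComplex.homologyFunctor _ _ n).mapIso
      (HomologicalComplex.Hom.isoOfComponents
        (fun i => (homLinearEquivOfAdjunction adj (P.complex.X i) Y).toModuleIso)
        (fun i j _ => ModuleCat.hom_ext (LinearMap.ext fun f =>
          (adj.homEquiv_naturality_left (P.complex.d j i) f).symm))) ≪≫
    (P.isoExt n (G.obj Y)).symm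

variable {K : Type u} [Field K] {A : Type u} [Ring A] [Algebra K A]

/-- Homomorphisms out of a finitely generated module commute with direct sums. -/
def homFinsuppEquiv (P N : ModuleCat.{u} A) [Module.Finite A P] (I : Type u) :
    (I →₀ (P ⟶ N)) ≃ₗ[K] (P ⟶ ModuleCat.of A (I →₀ N)) :=
  LinearEquiv.ofBijective
    (Finsupp.lsum K fun i => Linear.rightComp K P (ModuleCat.ofHom (Finsupp.lsingle i)))
    (by
      classical
      have key (c : I →₀ (P ⟶ N)) (p : P) (i : I) :
          (Finsupp.lsum K (fun i => Linear.rightComp K P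
            (ModuleCat.ofHom (Finsupp.lsingle (R := A) (M := N) i))) c).hom p i = c i p := by
        induction c using Finsupp.induction_linear with
        | zero => rw [map_zero]; rfl
        | add f g hf hg =>
          rw [map_add, ModuleCat.hom_add, LinearMap.add_apply, Finsupp.add_apply, hf, hg]
          rfl
        | single j f =>
          rw [Finsupp.lsum_single]
          change Finsupp.single j (f p) i = Finsupp.single j f i p
          by_cases h : j = i
          · subst h; simp
          · rw [Finsupp.single_eq_of_ne' h, Finsupp.single_eq_of_ne' h]; rfl
      refine ⟨fun c d h => ?_, fun f => ?_⟩
      · ext i p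
        rw [← key c p i, ← key d p i, h]
      · obtain ⟨s, hs⟩ := Module.Finite.fg_top (R := A) (M := P)
        let S : Finset I := s.biUnion fun p => (f p).support
        have hS (p : P) (i : I) (hi : i ∉ S) : f p i = 0 := by
          have : (Finsupp.lapply i ∘ₗ f.hom : P →ₗ[A] N) = 0 :=
            LinearMap.ext_on hs fun p hp => by
              by_contra hne
              exact hi (Finset.mem_biUnion.2 ⟨p, hp, Finsupp.mem_support_iff.2 hne⟩)
          exact LinearMap.congr_fun this p
        refine ⟨Finsupp.onFinset S
          (fun i => if i ∈ S then f ≫ ModuleCat.ofHom (Finsupp.lapply i) else 0)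
          (fun i hi => by by_contra h; simp [h] at hi), ?_⟩
        refine ModuleCat.hom_ext (LinearMap.ext fun p => Finsupp.ext fun i => ?_)
        refine (key _ p i).trans ?_
        rw [Finsupp.onFinset_apply]
        split_ifs with hi
        · rfl
        · exact (hS p i hi).symm)

lemma homFinsuppEquiv_single (P N : ModuleCat.{u} A) [Module.Finite A P] (I : Type u)
    (i : I) (f : P ⟶ N) : homFinsuppEquiv (K := K) P N I (Finsupp.single i f) =
      f ≫ ModuleCat.ofHom (Finsupp.lsingle i) := by
  change Finsupp.lsum K (fun i => Linear.rightComp K P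
    (ModuleCat.ofHom (Finsupp.lsingle (R := A) (M := N) i))) (Finsupp.single i f) = _
  rw [Finsupp.lsum_single]
  rfl

/-- Homomorphisms from a finitely generated module to a direct sum of copies of `N` indexed
by a basis of `W`. -/
def homTensorEquiv (P N : ModuleCat.{u} A) [Module.Finite A P] {W : Type u} [AddCommGroup W]
    [Module K W] {I : Type u} [DecidableEq I] (b : Module.Basis I K W) :
    (P ⟶ N) ⊗[K] W ≃ₗ[K] (P ⟶ ModuleCat.of A (I →₀ N)) :=
  TensorProduct.equivFinsuppOfBasisRight b ≪≫ₗ homFinsuppEquiv P N I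

lemma homTensorEquiv_tmul_basis (P N : ModuleCat.{u} A) [Module.Finite A P] {W : Type u}
    [AddCommGroup W] [Module K W] {I : Type u} [DecidableEq I] (b : Module.Basis I K W)
    (f : P ⟶ N) (i : I) :
    homTensorEquiv P N b (f ⊗ₜ b i) = f ≫ ModuleCat.ofHom (Finsupp.lsingle i) := by
  have : TensorProduct.equivFinsuppOfBasisRight b (f ⊗ₜ[K] b i) = Finsupp.single i f := by
    rw [LinearEquiv.eq_symm_apply _ |>.symm, TensorProduct.equivFinsuppOfBasisRight_symm_apply]
    simp
  rw [homTensorEquiv, LinearEquiv.trans_apply, this, homFinsuppEquiv_single]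

lemma homTensorEquiv_naturality {P Q : ModuleCat.{u} A} (d : Q ⟶ P) (N : ModuleCat.{u} A)
    [Module.Finite A P] [Module.Finite A Q] {W : Type u}
    [AddCommGroup W] [Module K W] {I : Type u} [DecidableEq I] (b : Module.Basis I K W)
    (t : (P ⟶ N) ⊗[K] W) :
    d ≫ homTensorEquiv P N b t =
      homTensorEquiv Q N b ((Linear.leftComp K N d).rTensor W t) := by
  have key : Linear.leftComp K (ModuleCat.of A (I →₀ N)) d ∘ₗ (homTensorEquiv P N b).toLinearMap =
      (homTensorEquiv Q N b).toLinearMap ∘ₗ (Linear.leftComp K N d).rTensor W := by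
    refine TensorProduct.ext (LinearMap.ext fun f => b.ext fun i => ?_)
    change d ≫ homTensorEquiv P N b (f ⊗ₜ b i) = homTensorEquiv Q N b ((d ≫ f) ⊗ₜ b i)
    rw [homTensorEquiv_tmul_basis, homTensorEquiv_tmul_basis, Category.assoc]
  exact LinearMap.congr_fun key t

/-- If `X` has a resolution by finitely generated projective modules, `Ext` from `X`
commutes with direct sums. -/
def extTensorIso {X : ModuleCat.{u} A} (P : ProjectiveResolution X)
    [∀ n, Module.Finite A (P.complex.X n)] (N : ModuleCat.{u} A) {W : Type u}
    [AddCommGroup W] [Module K W] {I : Type u} [DecidableEq I] (b : Module.Basis I K W) (n : ℕ) :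
    (MonoidalCategory.tensorRight (ModuleCat.of K W)).obj
        (((_root_.Ext K (ModuleCat.{u} A) n).obj (op X)).obj N) ≅
      ((_root_.Ext K (ModuleCat.{u} A) n).obj (op X)).obj (ModuleCat.of A (I →₀ N)) :=
  let T := MonoidalCategory.tensorRight (ModuleCat.of K W)
  let C := P.complex.linearYonedaObj K N
  T.mapIso (P.isoExt n N) ≪≫ ((C.sc n).mapHomologyIso T).symm ≪≫
    (HomologicalComplex.homologyFunctor _ _ n).mapIso
      (HomologicalComplex.Hom.isoOfComponents
        (C₁ := (T.mapHomologicalComplex _).obj C)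
        (C₂ := P.complex.linearYonedaObj K (ModuleCat.of A (I →₀ N)))
        (fun i => (homTensorEquiv (P.complex.X i) N b).toModuleIso)
        (fun i j _ => ModuleCat.hom_ext (LinearMap.ext fun t =>
          homTensorEquiv_naturality (P.complex.d j i) N b t))) ≪≫
    (P.isoExt n (ModuleCat.of A (I →₀ N))).symm

end Ext

end

theorem stmt11 (K : Type u) [Field K] (A : Type u) [Ring A] [Algebra K A]
    (G : Type u) [Group G] [Fintype G] (φ : G →* (A ≃ₐ[K] A))
    (B : Type u) [Ring B] [Algebra K B]
    (H : IsSkewGroupAlgebra K A G φ B)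
    (hchar : (Fintype.card G : K) ≠ 0)
    -- M : an A ∗ G-module
    (M : Type u) [AddCommGroup M] [Module B M] [Module A M] [Module K M]
    (hMA : ∀ (a : A) (m : M), H.ιA a • m = a • m)
    -- M admits a resolution by finitely generated projective A ∗ G-modules
    (hres : ∃ (Pc : ChainComplex (ModuleCat.{u} B) ℕ)
      (π : Pc ⟶ (ChainComplex.single₀ (ModuleCat.{u} B)).obj (ModuleCat.of B M)),
        (∀ n, CategoryTheory.Projective (Pc.X n) ∧ Module.Finite B (Pc.X n)) ∧
          QuasiIso π)
    -- N : an A ∗ G-module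
    (N : Type u) [AddCommGroup N] [Module B N] [Module A N] [Module K N]
    (hNA : ∀ (a : A) (n : N), H.ιA a • n = a • n)
    -- W : a KG-module
    (W : Type u) [AddCommGroup W] [Module K W] (ψ : G →* (W ≃ₗ[K] W))
    -- the twisted A ∗ G-module structure on M ⊗_K KG : (ag)(m ⊗ h) = a(gm) ⊗ gh
    [Module B (M ⊗[K] MonoidAlgebra K G)]
    (hMKG : ∀ (a : A) (g : G) (m : M) (h : G),
      (H.ιA a * H.ιG g) • (m ⊗ₜ[K] MonoidAlgebra.of K G h) =
        ((H.ιA a * H.ιG g) • m) ⊗ₜ[K] MonoidAlgebra.of K G (g * h))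
    -- the twisted A ∗ G-module structure on N ⊗_K W : (ag)(n ⊗ w) = a(gn) ⊗ gw
    [Module B (N ⊗[K] W)]
    (hNW : ∀ (a : A) (g : G) (n : N) (w : W),
      (H.ιA a * H.ιG g) • (n ⊗ₜ[K] w) = ((H.ιA a * H.ιG g) • n) ⊗ₜ[K] (ψ g w))
    (i : ℕ) :
    Nonempty
      (((((_root_.Ext K (ModuleCat.{u} A) i).obj (op (ModuleCat.of A M))).obj
            (ModuleCat.of A N) : Type u) ⊗[K] W) ≃ₗ[K]
        ((((_root_.Ext K (ModuleCat.{u} B) i).obj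
            (op (ModuleCat.of B (M ⊗[K] MonoidAlgebra K G)))).obj
            (ModuleCat.of B (N ⊗[K] W)) : Type u))) := by
  classical
  obtain ⟨Pc, π, hP, hπ⟩ := hres
  let P : ProjectiveResolution (ModuleCat.of B M) :=
    { complex := Pc
      projective := fun n => (hP n).1
      π := π
      quasiIso := hπ }
  let Q := H.res.mapProjectiveResolution P
  have hQ (n : ℕ) : Module.Finite A (Q.complex.X n) :=
    have := (hP n).2
    H.finite_res (Pc.X n)
  let eM : ModuleCat.of A M ≅ H.res.obj (ModuleCat.of B M) :=
    H.isoRes (AddEquiv.refl M) fun a m => (hMA a m).symm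
  obtain ⟨eT⟩ := H.nonempty_coind_iso (M := M) hMKG
  let b := Module.Basis.ofVectorSpace K W
  have hNW' (a : A) (n : N) (w : W) : H.ιA a • (n ⊗ₜ[K] w) = (H.ιA a • n) ⊗ₜ[K] w := by
    simpa using hNW a 1 n w
  let eN : ModuleCat.of A (Module.Basis.ofVectorSpaceIndex K W →₀ N) ≅
      H.res.obj (ModuleCat.of B (N ⊗[K] W)) :=
    H.isoRes (TensorProduct.equivFinsuppOfBasisRight b).symm.toAddEquiv fun a x => by
        change (TensorProduct.equivFinsuppOfBasisRight b).symm (a • x) =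
          H.ιA a • (TensorProduct.equivFinsuppOfBasisRight b).symm x
        induction x using Finsupp.induction_linear with
        | zero => simp
        | add x y hx hy => rw [smul_add, map_add, map_add, smul_add, hx, hy]
        | single j n =>
          rw [Finsupp.smul_single, TensorProduct.equivFinsuppOfBasisRight_symm_apply,
            TensorProduct.equivFinsuppOfBasisRight_symm_apply, Finsupp.sum_single_index (by simp),
            Finsupp.sum_single_index (by simp), hNW', hNA]
  let EA := _root_.Ext K (ModuleCat.{u} A) i
  let EB := _root_.Ext K (ModuleCat.{u} B) i
  exact ⟨((MonoidalCategory.tensorRight (ModuleCat.of K W)).mapIso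
      ((EA.mapIso eM.symm.op).app (ModuleCat.of A N)) ≪≫
    extTensorIso Q (ModuleCat.of A N) b i ≪≫
    (EA.obj (op (H.res.obj (ModuleCat.of B M)))).mapIso eN ≪≫
    (extIsoOfAdjunction H.coindResAdj (H.res.obj (ModuleCat.of B M))
      (ModuleCat.of B (N ⊗[K] W)) i).symm ≪≫
    (EB.mapIso eT.symm.op).app (ModuleCat.of B (N ⊗[K] W))).toLinearEquiv⟩
end
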